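/- Let A ∈ ℝ^{m×n} preserve Chebyshev systems, and let L ⊆ {-1,1}ⁿ be the set of fixed points of the sign transition map 𝒱 of the alternating minimization method. Then inf{‖A - u vᵀ‖_C : u ∈ ℝᵐ, v ∈ ℝⁿ} = min_{t ∈ L} E(A, t). -/

import Mathlib

open Filter

/-- A vector is Chebyshev if all of its components are non-zero. -/
def Cheb {n : ℕ} (v : Fin n → ℝ) : Prop := ∀ i, v i ≠ 0

/-- `mu a v` is the (unique, when `v` is Chebyshev) minimizer of `u ↦ ‖a - u • v‖`,
where `‖·‖` is the sup-norm on `Fin n → ℝ`. -/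
noncomputable def mu {n : ℕ} (a v : Fin n → ℝ) : ℝ :=
  Classical.epsilon fun t : ℝ => ∀ u : ℝ, ‖a - t • v‖ ≤ ‖a - u • v‖

noncomputable def phi {m n : ℕ} (A : Fin m → Fin n → ℝ) (v : Fin n → ℝ) : Fin m → ℝ :=
  fun i => mu (A i) v

noncomputable def psi {m n : ℕ} (A : Fin m → Fin n → ℝ) (u : Fin m → ℝ) : Fin n → ℝ :=
  fun j => mu (fun i => A i j) u

/-- `A` preserves Chebyshev systems. -/
def PreservesCheb {m n : ℕ} (A : Fin m → Fin n → ℝ) : Prop :=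
  (∀ v : Fin n → ℝ, Cheb v → Cheb (phi A v)) ∧ (∀ u : Fin m → ℝ, Cheb u → Cheb (psi A u))

/-- A vector is alternance-free if exactly one component attains the max absolute value. -/
def AlternanceFree {n : ℕ} (a : Fin n → ℝ) : Prop := ∃! i, |a i| = ‖a‖

/-- Chebyshev norm of the residual `A - u vᵀ`. -/
noncomputable def Cerr {m n : ℕ} (A : Fin m → Fin n → ℝ) (u : Fin m → ℝ) (v : Fin n → ℝ) : ℝ :=
  ⨆ i, ⨆ j, |A i j - u i * v j|

/-- Chebyshev norm of a matrix. -/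
noncomputable def CnormM {m n : ℕ} (A : Fin m → Fin n → ℝ) : ℝ :=
  ⨆ i, ⨆ j, |A i j|

/-- The sequence `v⁽ᵏ⁾` of the alternating minimization method started at `v0`. -/
noncomputable def vseq {m n : ℕ} (A : Fin m → Fin n → ℝ) (v0 : Fin n → ℝ) : ℕ → Fin n → ℝ
  | 0 => v0
  | k + 1 => psi A (phi A (vseq A v0 k))

/-- The limit error of the alternating minimization method started at `v`
(the error sequence is non-increasing and bounded below by 0, so its limit is its infimum). -/
noncomputable def EE {m n : ℕ} (A : Fin m → Fin n → ℝ) (v : Fin n → ℝ) : ℝ :=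
  ⨅ k : ℕ, Cerr A (phi A (vseq A v k)) (vseq A v k)

/-- The sign transition map 𝒱(t) = S(ψ(A, φ(A, t))). -/
noncomputable def SignV {m n : ℕ} (A : Fin m → Fin n → ℝ) (t : Fin n → ℝ) : Fin n → ℝ :=
  fun j => Real.sign (psi A (phi A t) j)

lemma mu_spec {n : ℕ} (a v : Fin n → ℝ) (u : ℝ) : ‖a - mu a v • v‖ ≤ ‖a - u • v‖ := by
  have hex : ∃ t : ℝ, ∀ u : ℝ, ‖a - t • v‖ ≤ ‖a - u • v‖ := by
    have hc : IsClosed ((Submodule.span ℝ {v} : Submodule ℝ (Fin n → ℝ)) : Set (Fin n → ℝ)) :=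
      Submodule.closed_of_finiteDimensional _
    obtain ⟨y, hy, hd⟩ := hc.exists_infDist_eq_dist ⟨0, Submodule.zero_mem _⟩ a
    obtain ⟨t, rfl⟩ := Submodule.mem_span_singleton.1 hy
    refine ⟨t, fun u => ?_⟩
    rw [← dist_eq_norm, ← dist_eq_norm, ← hd]
    exact Metric.infDist_le_dist_of_mem (Submodule.mem_span_singleton.2 ⟨u, rfl⟩)
  exact Classical.epsilon_spec hex u

lemma sign_mul_abs' (x : ℝ) : Real.sign x * x = |x| := by
  rcases lt_trichotomy x 0 with h | h | h
  · rw [Real.sign_of_neg h, abs_of_neg h]; ring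
  · simp [h]
  · rw [Real.sign_of_pos h, abs_of_pos h]; ring

lemma abs_sign' {x : ℝ} (h : x ≠ 0) : |Real.sign x| = 1 := by
  rcases Real.sign_apply_eq_of_ne_zero x h with h | h <;> simp [h]

lemma sign_sq' {x : ℝ} (h : x ≠ 0) : Real.sign x * Real.sign x = 1 := by
  rcases Real.sign_apply_eq_of_ne_zero x h with h | h <;> simp [h]

lemma alt_plus {n : ℕ} (hn : 0 < n) (a v : Fin n → ℝ) (hv : Cheb v) (t : ℝ)
    (ht : ∀ u : ℝ, ‖a - t • v‖ ≤ ‖a - u • v‖) :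
    ∃ j, Real.sign (v j) * (a j - t * v j) = ‖a - t • v‖ := by
  by_contra hcon
  push Not at hcon
  have hb : ∀ j, |Real.sign (v j) * (a j - t * v j)| ≤ ‖a - t • v‖ := by
    intro j
    rw [abs_mul, abs_sign' (hv j), one_mul]
    exact norm_le_pi_norm (a - t • v) j
  have hlt : ∀ j, Real.sign (v j) * (a j - t * v j) < ‖a - t • v‖ := fun j =>
    lt_of_le_of_ne (le_trans (le_abs_self _) (hb j)) (hcon j)
  have hev : ∀ᶠ ε in nhdsWithin (0 : ℝ) (Set.Ioi 0), ∀ j,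
      Real.sign (v j) * (a j - t * v j) + ε * |v j| < ‖a - t • v‖ := by
    rw [Filter.eventually_all]
    intro j
    have hc : Continuous fun ε : ℝ => Real.sign (v j) * (a j - t * v j) + ε * |v j| := by fun_prop
    have := hc.tendsto 0
    exact (this.eventually_lt_const (by simpa using hlt j)).filter_mono nhdsWithin_le_nhds
  obtain ⟨ε, h1, h2⟩ := (hev.and self_mem_nhdsWithin).exists
  have h2 : 0 < ε := h2
  have : Nonempty (Fin n) := ⟨⟨0, hn⟩⟩
  obtain ⟨j0, -⟩ : ∃ j : Fin n, True := ⟨⟨0, hn⟩, trivial⟩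
  have hpos : 0 < ‖a - t • v‖ := by
    have h3 := abs_le.1 (hb j0)
    have h4 := hlt j0
    linarith
  refine absurd (ht (t - ε)) (not_le.2 ?_)
  rw [pi_norm_lt_iff hpos]
  intro j
  have e1 : ‖(a - (t - ε) • v) j‖ = abs (Real.sign (v j) * (a j - t * v j) + ε * |v j|) := by
    rw [← sign_mul_abs' (v j)]
    have : Real.sign (v j) * (a j - t * v j) + ε * (Real.sign (v j) * v j)
      = Real.sign (v j) * (a j - (t - ε) * v j) := by ring
    rw [this, abs_mul, abs_sign' (hv j), one_mul]
    simp [Real.norm_eq_abs]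
  rw [e1, abs_lt]
  have h3 := abs_le.1 (hb j)
  have h5 : 0 < ε * |v j| := mul_pos h2 (abs_pos.2 (hv j))
  exact ⟨by linarith, h1 j⟩

lemma alt_minus {n : ℕ} (hn : 0 < n) (a v : Fin n → ℝ) (hv : Cheb v) (t : ℝ)
    (ht : ∀ u : ℝ, ‖a - t • v‖ ≤ ‖a - u • v‖) :
    ∃ j, Real.sign (v j) * (a j - t * v j) = -‖a - t • v‖ := by
  have e : ∀ u : ℝ, ‖-a - (-u) • v‖ = ‖a - u • v‖ := by
    intro u
    rw [← norm_neg]; congr 1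
    rw [neg_smul]; abel
  obtain ⟨j, hj⟩ := alt_plus hn (-a) v hv (-t) (by
    intro u
    have := ht (-u)
    rw [← e t, ← e (-u), neg_neg] at this
    exact this)
  refine ⟨j, ?_⟩
  rw [e] at hj
  rw [← hj]; simp only [Pi.neg_apply]; ring

lemma row_argmax {n : ℕ} (hn : 2 ≤ n) (a : Fin n → ℝ) (h : ∀ v, Cheb v → mu a v ≠ 0) :
    ∃ p, ∀ j, j ≠ p → |a j| < |a p| := by
  have : Nonempty (Fin n) := ⟨⟨0, by omega⟩⟩
  obtain ⟨p, hp⟩ := Finite.exists_max (fun j => |a j|)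
  refine ⟨p, fun q hq => lt_of_le_of_ne (hp q) fun heq => ?_⟩
  let sg : ℝ → ℝ := fun x => if 0 ≤ x then 1 else -1
  have hsg : ∀ x, sg x = 1 ∧ 0 ≤ x ∨ sg x = -1 ∧ x < 0 := by
    intro x
    by_cases hx : 0 ≤ x
    · left; exact ⟨if_pos hx, hx⟩
    · right; exact ⟨if_neg hx, not_le.1 hx⟩
  let v : Fin n → ℝ := fun j => if j = q then - sg (a q) else sg (a j)
  have hvq : v q = - sg (a q) := if_pos rfl
  have hvp : v p = sg (a p) := if_neg (Ne.symm hq)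
  have hv : Cheb v := by
    intro j
    by_cases hj : j = q
    · subst hj; rw [hvq]
      rcases hsg (a j) with h | h <;> rw [h.1] <;> norm_num
    · have : v j = sg (a j) := if_neg hj
      rw [this]
      rcases hsg (a j) with h | h <;> rw [h.1] <;> norm_num
  refine h v hv ?_
  set t := mu a v with htdef
  have h0 : ‖a - t • v‖ ≤ |a p| := by
    refine (mu_spec a v 0).trans ?_
    rw [zero_smul, sub_zero, pi_norm_le_iff_of_nonneg (abs_nonneg _)]
    exact hp
  have hP : |a p - t * v p| ≤ |a p| := (norm_le_pi_norm (a - t • v) p).trans h0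
  have hQ : |a q - t * v q| ≤ |a p| := (norm_le_pi_norm (a - t • v) q).trans h0
  rw [← heq] at hQ
  rw [hvp] at hP
  rw [hvq] at hQ
  apply le_antisymm
  · rcases hsg (a q) with ⟨h1, h2⟩ | ⟨h1, h2⟩
    · rw [h1, abs_of_nonneg h2] at hQ; have := (abs_le.1 hQ).2; linarith
    · rw [h1, abs_of_neg h2] at hQ; have := (abs_le.1 hQ).1; linarith
  · rcases hsg (a p) with ⟨h1, h2⟩ | ⟨h1, h2⟩
    · rw [h1, abs_of_nonneg h2] at hP; have := (abs_le.1 hP).2; linarith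
    · rw [h1, abs_of_neg h2] at hP; have := (abs_le.1 hP).1; linarith

lemma argmax_pos {n : ℕ} (hn : 2 ≤ n) (a : Fin n → ℝ) (p : Fin n)
    (hp : ∀ j, j ≠ p → |a j| < |a p|) : 0 < |a p| := by
  have : Nontrivial (Fin n) := Fin.nontrivial_iff_two_le.2 hn
  obtain ⟨j, hj⟩ := exists_ne p
  exact lt_of_le_of_lt (abs_nonneg _) (hp j hj)

lemma norm_argmax {n : ℕ} (a : Fin n → ℝ) (p : Fin n)
    (hp : ∀ j, j ≠ p → |a j| < |a p|) : ‖a‖ = |a p| := by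
  apply le_antisymm
  · rw [pi_norm_le_iff_of_nonneg (abs_nonneg _)]
    intro j
    by_cases h : j = p
    · rw [h]; exact le_rfl
    · exact (hp j h).le
  · exact norm_le_pi_norm a p

lemma sign_mu {n : ℕ} (hn : 2 ≤ n) (a : Fin n → ℝ) (h : ∀ v, Cheb v → mu a v ≠ 0) (p : Fin n)
    (hp : ∀ j, j ≠ p → |a j| < |a p|) (v : Fin n → ℝ) (hv : Cheb v) :
    Real.sign (mu a v) = Real.sign (a p) * Real.sign (v p) := by
  have hap := argmax_pos hn a p hp
  have h1 := mu_spec a v 0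
  rw [zero_smul, sub_zero, norm_argmax a p hp] at h1
  have h2 : |a p - mu a v * v p| ≤ |a p| := (norm_le_pi_norm (a - mu a v • v) p).trans h1
  have h3 := h v hv
  have h4 := hv p
  have h5 : a p ≠ 0 := abs_pos.1 hap
  have key : 0 < mu a v * v p * a p := by
    have := sq_le_sq.2 h2
    have h6 : 0 < (mu a v * v p)^2 := by positivity
    nlinarith
  rcases lt_or_gt_of_ne h4 with k4 | k4 <;> rcases lt_or_gt_of_ne h5 with k5 | k5 <;>
    rcases lt_or_gt_of_ne h3 with k3 | k3
  all_goals first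
    | (simp [Real.sign_of_neg, Real.sign_of_pos, k3, k4, k5]; done)
    | (exfalso; revert key; rw [imp_false, not_lt])
  · have := mul_neg_of_neg_of_pos (mul_pos_of_neg_of_neg k3 k4 |> neg_neg_of_pos) (neg_pos.2 k5)
    nlinarith [mul_pos (mul_pos_of_neg_of_neg k3 k4) (neg_pos.2 k5)]
  · nlinarith [mul_pos (mul_pos k3 (neg_pos.2 k4)) k5]
  · nlinarith [mul_pos (mul_pos k3 k4) (neg_pos.2 k5)]
  · nlinarith [mul_pos (mul_pos (neg_pos.2 k3) k4) k5]

lemma mu_bounds {n : ℕ} (hn : 2 ≤ n) (a : Fin n → ℝ) (p : Fin n)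
    (hp : ∀ j, j ≠ p → |a j| < |a p|) :
    ∃ K : ℝ, 0 < K ∧ ∀ v, Cheb v → |mu a v| * ‖v‖ ≤ K ∧ 1 ≤ K * (|mu a v| * ‖v‖) := by
  have : Nontrivial (Fin n) := Fin.nontrivial_iff_two_le.2 hn
  have hap := argmax_pos hn a p hp
  obtain ⟨b, hb0, hb, hbp⟩ : ∃ b, 0 ≤ b ∧ (∀ j, j ≠ p → |a j| ≤ b) ∧ b < |a p| := by
    have : Nonempty {j // j ≠ p} := by
      obtain ⟨j, hj⟩ := exists_ne p
      exact ⟨⟨j, hj⟩⟩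
    obtain ⟨q, hq⟩ := Finite.exists_max (fun j : {j // j ≠ p} => |a j|)
    exact ⟨|a q|, abs_nonneg _, fun j hj => hq ⟨j, hj⟩, hp q q.2⟩
  set g := (|a p| - b) / 2 with hg
  have hgpos : 0 < g := by rw [hg]; linarith
  have key : ∀ v, Cheb v → |mu a v| * ‖v‖ ≤ 2 * |a p| ∧ g ≤ |mu a v| * ‖v‖ := by
    intro v hv
    have h1 := mu_spec a v 0
    rw [zero_smul, sub_zero, norm_argmax a p hp] at h1
    constructor
    · calc |mu a v| * ‖v‖ = ‖mu a v • v‖ := by rw [norm_smul, Real.norm_eq_abs]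
        _ = ‖a - (a - mu a v • v)‖ := by rw [sub_sub_cancel]
        _ ≤ ‖a‖ + ‖a - mu a v • v‖ := norm_sub_le _ _
        _ ≤ 2 * |a p| := by rw [norm_argmax a p hp]; linarith
    · by_contra hlt
      rw [not_le] at hlt
      set e := ‖a - mu a v • v‖ with he
      have hm : ∀ j, |mu a v * v j| < g := fun j => by
        rw [abs_mul]
        exact lt_of_le_of_lt (mul_le_mul_of_nonneg_left (norm_le_pi_norm v j) (abs_nonneg _)) hlt
      have hpe : |a p - mu a v * v p| ≤ e := norm_le_pi_norm (a - mu a v • v) p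
      have hpe2 : |a p| - g < e := by
        have := abs_sub_abs_le_abs_sub (a p) (mu a v * v p)
        have := hm p
        linarith
      have hne : ∀ j, |a j - mu a v * v j| = e → j = p := by
        intro j hj
        by_contra hjp
        have := abs_sub (a j) (mu a v * v j)
        have := hm j
        have := hb j hjp
        linarith
      obtain ⟨j, hj⟩ := alt_plus (by omega) a v hv _ (mu_spec a v)
      obtain ⟨k, hk⟩ := alt_minus (by omega) a v hv _ (mu_spec a v)
      rw [← he] at hj hk
      have hepos : 0 < e := by linarith
      have hjp : j = p := hne j (by
        have := congrArg abs hj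
        rwa [abs_mul, abs_sign' (hv j), one_mul, abs_of_pos hepos] at this)
      have hkp : k = p := hne k (by
        have := congrArg abs hk
        rwa [abs_mul, abs_sign' (hv k), one_mul, abs_neg, abs_of_pos hepos] at this)
      subst hjp
      subst hkp
      linarith
  refine ⟨2 * |a p| + 1 / g, by positivity, fun v hv => ⟨(key v hv).1.trans ?_, ?_⟩⟩
  · have : 0 < 1 / g := by positivity
    linarith
  · have h2 := (key v hv).2
    calc (1 : ℝ) = (1 / g) * g := by field_simp
      _ ≤ (2 * |a p| + 1 / g) * (|mu a v| * ‖v‖) := by gcongr; linarith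

/-- comparability of the components of `phi A v` -/
lemma phi_comp {m n : ℕ} (hn : 2 ≤ n) (A : Fin m → Fin n → ℝ)
    (h : ∀ v : Fin n → ℝ, Cheb v → Cheb (phi A v)) :
    ∃ C : ℝ, ∀ v, Cheb v → ∀ i i', |phi A v i| ≤ C * |phi A v i'| := by
  choose p hp using fun i => row_argmax hn (A i) (fun v hv => h v hv i)
  choose K hK0 hK using fun i => mu_bounds hn (A i) (p i) (hp i)
  have hS : ∀ i, K i ≤ ∑ i, K i := fun i =>
    Finset.single_le_sum (f := K) (fun j _ => (hK0 j).le) (Finset.mem_univ i)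
  refine ⟨(∑ i, K i) * (∑ i, K i), fun v hv i i' => ?_⟩
  have hvpos : 0 < ‖v‖ := by
    rw [norm_pos_iff]; intro h0
    exact hv ⟨0, by omega⟩ (by rw [h0]; rfl)
  have h1 := (hK i v hv).1.trans (hS i)
  have h2 := (hK i' v hv).2
  have hSp : 0 < ∑ i, K i := (hK0 i).trans_le (hS i)
  have h3 : 1 ≤ (∑ i, K i) * (|mu (A i') v| * ‖v‖) :=
    h2.trans (mul_le_mul_of_nonneg_right (hS i') (by positivity))
  have h4 : |phi A v i| * ‖v‖ ≤ ((∑ i, K i) * (∑ i, K i) * |phi A v i'|) * ‖v‖ := by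
    calc |phi A v i| * ‖v‖ ≤ (∑ i, K i) * 1 := by rw [mul_one]; exact h1
      _ ≤ (∑ i, K i) * ((∑ i, K i) * (|mu (A i') v| * ‖v‖)) := by gcongr
      _ = _ := by simp only [phi]; ring
  exact le_of_mul_le_mul_right h4 hvpos

lemma le_Cerr {m n : ℕ} (A : Fin m → Fin n → ℝ) (u : Fin m → ℝ) (v : Fin n → ℝ) (i : Fin m)
    (j : Fin n) : |A i j - u i * v j| ≤ Cerr A u v := by
  refine le_trans ?_ (le_ciSup (f := fun i => ⨆ j, |A i j - u i * v j|) (Set.finite_range _).bddAbove i)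
  exact le_ciSup (f := fun j => |A i j - u i * v j|) (Set.finite_range _).bddAbove j

lemma Cerr_nonneg {m n : ℕ} (A : Fin m → Fin n → ℝ) (u : Fin m → ℝ) (v : Fin n → ℝ) :
    0 ≤ Cerr A u v :=
  Real.iSup_nonneg fun _ => Real.iSup_nonneg fun _ => abs_nonneg _

lemma Cerr_le {m n : ℕ} (A : Fin m → Fin n → ℝ) (u : Fin m → ℝ) (v : Fin n → ℝ) (c : ℝ)
    (hc : 0 ≤ c) (h : ∀ i j, |A i j - u i * v j| ≤ c) : Cerr A u v ≤ c :=
  Real.iSup_le (fun i => Real.iSup_le (fun j => h i j) hc) hc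

lemma Cerr_attained {m n : ℕ} (hm : 0 < m) (hn : 0 < n) (A : Fin m → Fin n → ℝ)
    (u : Fin m → ℝ) (v : Fin n → ℝ) : ∃ i j, |A i j - u i * v j| = Cerr A u v := by
  have : Nonempty (Fin m) := ⟨⟨0, hm⟩⟩
  have : Nonempty (Fin n) := ⟨⟨0, hn⟩⟩
  obtain ⟨i, hi⟩ := exists_eq_ciSup_of_finite (f := fun i => ⨆ j, |A i j - u i * v j|)
  obtain ⟨j, hj⟩ := exists_eq_ciSup_of_finite (f := fun j => |A i j - u i * v j|)
  exact ⟨i, j, hj.trans hi⟩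

lemma Cerr_phi_le {m n : ℕ} (A : Fin m → Fin n → ℝ) (u : Fin m → ℝ) (v : Fin n → ℝ) :
    Cerr A (phi A v) v ≤ Cerr A u v := by
  refine Cerr_le _ _ _ _ (Cerr_nonneg _ _ _) fun i j => ?_
  refine (norm_le_pi_norm (A i - phi A v i • v) j).trans ((mu_spec (A i) v (u i)).trans ?_)
  rw [pi_norm_le_iff_of_nonneg (Cerr_nonneg _ _ _)]
  exact fun j => le_Cerr A u v i j

lemma Cerr_transpose {m n : ℕ} (A : Fin m → Fin n → ℝ) (u : Fin m → ℝ) (v : Fin n → ℝ) :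
    Cerr A u v = Cerr (fun j i => A i j) v u := by
  apply le_antisymm
  · refine Cerr_le _ _ _ _ (Cerr_nonneg _ _ _) fun i j => ?_
    rw [mul_comm]; exact le_Cerr (fun j i => A i j) v u j i
  · refine Cerr_le _ _ _ _ (Cerr_nonneg _ _ _) fun j i => ?_
    rw [mul_comm]; exact le_Cerr A u v i j

lemma Cerr_psi_le {m n : ℕ} (A : Fin m → Fin n → ℝ) (u : Fin m → ℝ) (v : Fin n → ℝ) :
    Cerr A u (psi A u) ≤ Cerr A u v := by
  rw [Cerr_transpose A u, Cerr_transpose A u]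
  exact Cerr_phi_le (fun j i => A i j) v u

/-- One backward half step. -/
lemma half_step {ι κ : Type*} (B : ι → κ → ℝ) (q qs : ι → ℝ) (p r ps : κ → ℝ)
    (E ε η C Es γ δ : ℝ)
    (hq : ∀ i, 0 < q i)
    (hC : ∀ i i', q i ≤ C * q i')
    (hε : 0 ≤ ε) (hη : 0 ≤ η) (hγ : 0 ≤ γ)
    (hup : ∀ i j, |B i j - q i * p j| ≤ E + ε)
    (halt : ∀ i, ∃ e, (∀ j, |B i j - q i * p j| ≤ e) ∧ (∃ j, B i j - q i * p j = e) ∧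
      (∃ j, B i j - q i * p j = -e))
    (hs : ∀ i j, |B i j - qs i * ps j| ≤ Es)
    (hδ : ∀ i j, δ * (qs i * ps j) ≤ γ)
    (hE : Es + γ ≤ E - η)
    (j : κ) (h1 : ∃ i, E - η ≤ B i j - q i * r j) (h2 : ∃ i, B i j - q i * r j ≤ -(E - η)) :
    (∃ i, q i * r j ≤ qs i * ps j ∧ (∃ k, E - (η + C * (ε + η)) ≤ B i k - q i * p k) ∧
      (∃ k, B i k - q i * p k ≤ -(E - (η + C * (ε + η))))) ∧
    (∃ i, (1 + δ) * (qs i * ps j) ≤ q i * r j ∧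
      (∃ k, E - (η + C * (ε + η)) ≤ B i k - q i * p k) ∧
      (∃ k, B i k - q i * p k ≤ -(E - (η + C * (ε + η))))) := by
  obtain ⟨i, hi⟩ := h1
  obtain ⟨i', hi'⟩ := h2
  have a1 := (abs_le.1 (hup i j)).2
  have a2 := (abs_le.1 (hup i' j)).1
  have b1 : q i * (r j - p j) ≤ ε + η := by linarith
  have b2 : q i' * (p j - r j) ≤ ε + η := by linarith
  have hCnn : ∀ x y, q x * (p j - r j) ≤ ε + η → q y * (p j - r j) ≤ C * (ε + η) := by
    intro x y hxy
    have hCx : 0 ≤ C := by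
      by_contra hneg
      nlinarith [hC x x, hq x]
    rcases le_total 0 (p j - r j) with hs | hs
    · calc q y * (p j - r j) ≤ C * q x * (p j - r j) := mul_le_mul_of_nonneg_right (hC y x) hs
        _ = C * (q x * (p j - r j)) := by ring
        _ ≤ _ := mul_le_mul_of_nonneg_left hxy hCx
    · have := mul_nonpos_of_nonneg_of_nonpos (hq y).le hs
      have : 0 ≤ C * (ε + η) := by positivity
      linarith
  have hCnn' : ∀ x y, q x * (r j - p j) ≤ ε + η → q y * (r j - p j) ≤ C * (ε + η) := by
    intro x y hxy
    have hCx : 0 ≤ C := by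
      by_contra hneg
      nlinarith [hC x x, hq x]
    rcases le_total 0 (r j - p j) with hs | hs
    · calc q y * (r j - p j) ≤ C * q x * (r j - p j) := mul_le_mul_of_nonneg_right (hC y x) hs
        _ = C * (q x * (r j - p j)) := by ring
        _ ≤ _ := mul_le_mul_of_nonneg_left hxy hCx
    · have := mul_nonpos_of_nonneg_of_nonpos (hq y).le hs
      have : 0 ≤ C * (ε + η) := by positivity
      linarith
  have c1 := hCnn i' i b2
  have c2 := hCnn' i i' b1
  constructor
  · refine ⟨i, ?_, ⟨j, by linarith⟩, ?_⟩
    · have := (abs_le.1 (hs i j)).2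
      linarith
    · obtain ⟨e, he, -, k, hk⟩ := halt i
      refine ⟨k, ?_⟩
      have := (abs_le.1 (he j)).2
      linarith
  · refine ⟨i', ?_, ?_, ⟨j, by linarith⟩⟩
    · have := (abs_le.1 (hs i' j)).1
      have := hδ i' j
      linarith
    · obtain ⟨e, he, ⟨k, hk⟩, -⟩ := halt i'
      refine ⟨k, ?_⟩
      have := (abs_le.1 (he j)).1
      linarith

/-- Approximate alternance in row `i`. -/
def RowState {ι κ : Type*} (B : ι → κ → ℝ) (q : ι → ℝ) (p : κ → ℝ) (E η : ℝ) (i : ι) : Prop :=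
  (∃ k, E - η ≤ B i k - q i * p k) ∧ (∃ k, B i k - q i * p k ≤ -(E - η))

/-- Exact alternance in every row. -/
def RowAlt {ι κ : Type*} (B : ι → κ → ℝ) (q : ι → ℝ) (p : κ → ℝ) : Prop :=
  ∀ i, ∃ e, (∀ j, |B i j - q i * p j| ≤ e) ∧ (∃ j, B i j - q i * p j = e) ∧
      (∃ j, B i j - q i * p j = -e)

lemma half_step' {ι κ : Type*} (B : ι → κ → ℝ) (q qs : ι → ℝ) (p r ps : κ → ℝ)
    (E ε η C Es γ δ : ℝ)
    (hq : ∀ i, 0 < q i)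
    (hC0 : 0 ≤ C) (hC : ∀ i i', q i ≤ C * q i')
    (hε : 0 ≤ ε) (hη : ε ≤ η) (hγ : 0 ≤ γ)
    (hup : ∀ i j, |B i j - q i * p j| ≤ E + ε)
    (halt : RowAlt B q p)
    (hs : ∀ i j, |B i j - qs i * ps j| ≤ Es)
    (hδ : ∀ i j, δ * (qs i * ps j) ≤ γ)
    (hE : Es + γ ≤ E - η)
    (j : κ) (h : RowState (fun j i => B i j) r q E η j) :
    (∃ i, q i * r j ≤ qs i * ps j ∧ RowState B q p E (η * (1 + 2 * C)) i) ∧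
    (∃ i, (1 + δ) * (qs i * ps j) ≤ q i * r j ∧ RowState B q p E (η * (1 + 2 * C)) i) := by
  obtain ⟨h1, h2⟩ := h
  have hle : η + C * (ε + η) ≤ η * (1 + 2 * C) := by nlinarith
  have mono : ∀ i, ((∃ k, E - (η + C * (ε + η)) ≤ B i k - q i * p k) ∧
      (∃ k, B i k - q i * p k ≤ -(E - (η + C * (ε + η))))) →
      RowState B q p E (η * (1 + 2 * C)) i := by
    rintro i ⟨⟨k, hk⟩, ⟨k', hk'⟩⟩
    exact ⟨⟨k, by linarith⟩, ⟨k', by linarith⟩⟩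
  obtain ⟨⟨i, a, b⟩, ⟨i', a', b'⟩⟩ := half_step B q qs p r ps E ε η C Es γ δ hq hC hε
    (hε.trans hη) hγ hup halt hs hδ hE j
    (by obtain ⟨i, hi⟩ := h1; exact ⟨i, by rw [mul_comm]; exact hi⟩)
    (by obtain ⟨i, hi⟩ := h2; exact ⟨i, by rw [mul_comm]; exact hi⟩)
  exact ⟨⟨i, a, mono i b⟩, ⟨i', a', mono i' b'⟩⟩

lemma full_step {ι κ : Type*} (B : ι → κ → ℝ) (u u' us : ι → ℝ) (v v' vs : κ → ℝ)
    (E ε η C Es γ δ : ℝ)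
    (hu : ∀ i, 0 < u i) (hus : ∀ i, 0 < us i)
    (hv' : ∀ j, 0 < v' j)
    (hC0 : 0 ≤ C) (hCu : ∀ i i', u i ≤ C * u i') (hCv : ∀ i i', v' i ≤ C * v' i')
    (hε : 0 ≤ ε) (hη : ε ≤ η) (hγ : 0 ≤ γ) (hδ0 : 0 ≤ δ)
    (hup : ∀ i j, |B i j - u i * v j| ≤ E + ε)
    (hup' : ∀ i j, |B i j - u i * v' j| ≤ E + ε)
    (halt : RowAlt B u v) (halt' : RowAlt (fun j i => B i j) v' u)
    (hs : ∀ i j, |B i j - us i * vs j| ≤ Es)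
    (hδ : ∀ i j, δ * (us i * vs j) ≤ γ)
    (hE : Es + γ ≤ E - η * (1 + 2 * C))
    (i : ι) (h : RowState B u' v' E η i) :
    (∃ i1, (1 + δ) * (u' i / us i) ≤ u i1 / us i1 ∧ RowState B u v E (η * (1 + 2 * C)^2) i1) ∧
    (∃ i2, (1 + δ) * (u i2 / us i2) ≤ u' i / us i ∧ RowState B u v E (η * (1 + 2 * C)^2) i2) := by
  have hη0 : 0 ≤ η := hε.trans hη
  have hηD : η ≤ η * (1 + 2 * C) := by nlinarith
  obtain ⟨⟨j, a, b⟩, ⟨j', a', b'⟩⟩ := half_step' (fun j i => B i j) v' vs u u' us E ε η C Es γ δ hv'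
    hC0 hCv hε hη hγ (fun j i => by rw [mul_comm]; exact hup' i j) halt'
    (fun j i => by rw [mul_comm]; exact hs i j) (fun j i => by rw [mul_comm (vs j)]; exact hδ i j)
    (by linarith) i h
  have e : η * (1 + 2 * C) * (1 + 2 * C) = η * (1 + 2 * C)^2 := by ring
  have step := fun j => half_step' B u us v v' vs E ε (η * (1 + 2 * C)) C Es γ δ hu hC0 hCu hε
    (hη.trans hηD) hγ hup halt hs hδ hE j
  rw [e] at step
  obtain ⟨-, ⟨i1, c, d⟩⟩ := step j b
  obtain ⟨⟨i2, c', d'⟩, -⟩ := step j' b'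
  refine ⟨⟨i1, ?_, d⟩, ⟨i2, ?_, d'⟩⟩
  · rw [← mul_div_assoc, div_le_div_iff₀ (hus _) (hus _)]
    refine le_of_mul_le_mul_right ?_ (hv' j)
    calc (1 + δ) * u' i * us i1 * v' j = (1 + δ) * us i1 * (v' j * u' i) := by ring
      _ ≤ (1 + δ) * us i1 * (vs j * us i) := by
        have := (hus i1).le
        gcongr
      _ = (1 + δ) * (us i1 * vs j) * us i := by ring
      _ ≤ u i1 * v' j * us i := mul_le_mul_of_nonneg_right c (hus i).le
      _ = _ := by ring
  · rw [← mul_div_assoc, div_le_div_iff₀ (hus _) (hus _)]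
    refine le_of_mul_le_mul_right ?_ (hv' j')
    calc (1 + δ) * u i2 * us i * v' j' = (1 + δ) * us i * (u i2 * v' j') := by ring
      _ ≤ (1 + δ) * us i * (us i2 * vs j') := by
        have := (hus i).le
        gcongr
      _ = (1 + δ) * (vs j' * us i) * us i2 := by ring
      _ ≤ v' j' * u' i * us i2 := mul_le_mul_of_nonneg_right a' (hus i2).le
      _ = _ := by ring

lemma chain {ι κ : Type*} (B : ι → κ → ℝ) (U : ℕ → ι → ℝ) (V : ℕ → κ → ℝ) (us : ι → ℝ)
    (vs : κ → ℝ) (E ε C Es γ δ : ℝ) (k : ℕ)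
    (hU : ∀ k i, 0 < U k i) (hus : ∀ i, 0 < us i)
    (hV : ∀ k j, 0 < V k j)
    (hC0 : 0 ≤ C) (hCU : ∀ k i i', U k i ≤ C * U k i') (hCV : ∀ k i i', V k i ≤ C * V k i')
    (hε : 0 ≤ ε) (hγ : 0 ≤ γ) (hδ0 : 0 ≤ δ)
    (hup : ∀ l, k ≤ l → ∀ i j, |B i j - U l i * V l j| ≤ E + ε)
    (hup' : ∀ l, k ≤ l → ∀ i j, |B i j - U l i * V (l + 1) j| ≤ E + ε)
    (halt : ∀ k, RowAlt B (U k) (V k)) (halt' : ∀ k, RowAlt (fun j i => B i j) (V (k + 1)) (U k))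
    (hs : ∀ i j, |B i j - us i * vs j| ≤ Es)
    (hδ : ∀ i j, δ * (us i * vs j) ≤ γ) (hE : Es + γ ≤ E - γ) (s : ℕ) :
    ∀ (η : ℝ), ε ≤ η → η * ((1 + 2 * C)^2)^s ≤ γ → ∀ i,
    RowState B (U (k + s)) (V (k + s)) E η i →
    (∃ i1, (1 + δ)^s * (U (k + s) i / us i) ≤ U k i1 / us i1) ∧
    (∃ i2, (1 + δ)^s * (U k i2 / us i2) ≤ U (k + s) i / us i) := by
  induction s with
  | zero => intro η _ _ i _; exact ⟨⟨i, by simp⟩, ⟨i, by simp⟩⟩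
  | succ s ih =>
    intro η hη hηγ i h
    have hη0 := hε.trans hη
    have hD1 : 1 ≤ 1 + 2 * C := by linarith
    have hD2 : 1 ≤ ((1 + 2 * C)^2)^s := one_le_pow₀ (one_le_pow₀ hD1)
    have e1 : η * ((1 + 2 * C)^2) * ((1 + 2 * C)^2)^s = η * ((1 + 2 * C)^2)^(s+1) := by ring
    have hlt : η * (1 + 2 * C) ≤ γ := by
      calc η * (1 + 2 * C) ≤ η * ((1 + 2 * C)^2)^(s+1) := by
            gcongr
            rw [pow_succ]
            calc (1 + 2 * C) = 1 * (1 * (1 + 2 * C)) := by ring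
              _ ≤ ((1 + 2 * C)^2)^s * ((1 + 2 * C) * (1 + 2 * C)) := by gcongr
              _ = _ := by ring
        _ ≤ γ := hηγ
    obtain ⟨⟨i1, a, b⟩, ⟨i2, c, d⟩⟩ := full_step B (U (k + s)) (U (k + s + 1)) us (V (k + s))
      (V (k + s + 1)) vs E ε η C Es γ δ (hU _) hus (hV _) hC0 (hCU _) (hCV _) hε hη hγ hδ0
      (hup _ (by omega)) (hup' _ (by omega)) (halt _) (halt' _) hs hδ (by linarith) i h
    have hη' : ε ≤ η * (1 + 2 * C)^2 := by
      have : 1 ≤ (1 + 2 * C)^2 := one_le_pow₀ hD1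
      nlinarith
    obtain ⟨⟨l, hl⟩, -⟩ := ih (η * (1 + 2 * C)^2) hη' (by rw [e1]; exact hηγ) i1 b
    obtain ⟨-, ⟨l', hl'⟩⟩ := ih (η * (1 + 2 * C)^2) hη' (by rw [e1]; exact hηγ) i2 d
    refine ⟨⟨l, le_trans ?_ hl⟩, ⟨l', le_trans ?_ c⟩⟩
    · rw [pow_succ, mul_assoc]; gcongr; exact a
    · rw [pow_succ, mul_comm ((1 + δ)^s), mul_assoc]; gcongr

lemma main_abstract {ι κ : Type*} [Finite ι] [Finite κ]
    (B : ι → κ → ℝ) (U : ℕ → ι → ℝ) (V : ℕ → κ → ℝ) (us : ι → ℝ)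
    (vs : κ → ℝ) (E C Es : ℝ)
    (hU : ∀ k i, 0 < U k i) (hus : ∀ i, 0 < us i)
    (hV : ∀ k j, 0 < V k j) (hvs : ∀ j, 0 < vs j)
    (hC0 : 0 ≤ C) (hCU : ∀ k i i', U k i ≤ C * U k i') (hCV : ∀ k i i', V k i ≤ C * V k i')
    (hlow : ∀ k, ∃ i j, E ≤ |B i j - U k i * V k j|)
    (hup : ∀ ε, 0 < ε → ∃ k, ∀ l, k ≤ l → ∀ i j, |B i j - U l i * V l j| ≤ E + ε ∧
      |B i j - U l i * V (l + 1) j| ≤ E + ε)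
    (halt : ∀ k, RowAlt B (U k) (V k)) (halt' : ∀ k, RowAlt (fun j i => B i j) (V (k + 1)) (U k))
    (hs : ∀ i j, |B i j - us i * vs j| ≤ Es) : E ≤ Es := by
  by_contra hcon
  rw [not_le] at hcon
  obtain ⟨i0, j0, -⟩ := hlow 0
  have : Nonempty ι := ⟨i0⟩
  have : Nonempty κ := ⟨j0⟩
  set γ := (E - Es) / 2 with hγd
  have hγ : 0 < γ := by rw [hγd]; linarith
  obtain ⟨im, him⟩ := Finite.exists_max us
  obtain ⟨jm, hjm⟩ := Finite.exists_max vs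
  obtain ⟨il, hil⟩ := Finite.exists_min us
  set δ := γ / (us im * vs jm) with hδd
  have hM : 0 < us im * vs jm := mul_pos (hus _) (hvs _)
  have hδ0 : 0 < δ := div_pos hγ hM
  have hδ : ∀ i j, δ * (us i * vs j) ≤ γ := by
    intro i j
    have h1 : us i * vs j ≤ us im * vs jm :=
      mul_le_mul (him i) (hjm j) (hvs j).le (hus im).le
    calc δ * (us i * vs j) ≤ δ * (us im * vs jm) := by gcongr
      _ = γ := div_mul_cancel₀ _ hM.ne'
  obtain ⟨K, hK⟩ := pow_unbounded_of_one_lt (C * (us im / us il)) (show 1 < 1 + δ by linarith)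
  have hDpos : 0 < ((1 + 2 * C)^2)^K := by positivity
  set ε := γ / ((1 + 2 * C)^2)^K with hεd
  have hε : 0 < ε := div_pos hγ hDpos
  obtain ⟨k, hk⟩ := hup ε hε
  obtain ⟨i, j, hij⟩ := hlow (k + K)
  have hst : RowState B (U (k + K)) (V (k + K)) E ε i := by
    obtain ⟨e, he, ⟨a, ha⟩, ⟨b, hb⟩⟩ := halt (k + K) i
    have := he j
    exact ⟨⟨a, by linarith⟩, ⟨b, by linarith⟩⟩
  obtain ⟨⟨i1, h1⟩, ⟨i2, h2⟩⟩ := chain B U V us vs E ε C Es γ δ k hU hus hV hC0 hCU hCV hε.le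
    hγ.le hδ0.le (fun l hl i j => (hk l hl i j).1) (fun l hl i j => (hk l hl i j).2) halt halt' hs
    hδ (by rw [hγd]; linarith) K ε le_rfl (by rw [hεd]; field_simp; exact le_rfl) i hst
  have hX : 0 < U k i2 / us i2 := div_pos (hU _ _) (hus _)
  have hp1 : 1 ≤ (1 + δ)^K := one_le_pow₀ (by linarith)
  have hp0 : 0 < U (k + K) i / us i := div_pos (hU _ _) (hus _)
  have h3 : (1 + δ)^K * (U k i2 / us i2) ≤ U k i1 / us i1 := by nlinarith
  have h4 : U k i1 / us i1 ≤ C * (us im / us il) * (U k i2 / us i2) := by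
    calc U k i1 / us i1 ≤ C * U k i2 / us il := by
          have hn : 0 ≤ C * U k i2 := mul_nonneg hC0 (hU _ _).le
          exact div_le_div₀ hn (hCU k i1 i2) (hus _) (hil _)
      _ = C * (us i2 / us il) * (U k i2 / us i2) := by
          have := (hus i2).ne'
          field_simp
      _ ≤ _ := by
          have := (hus il).le
          have := him i2
          gcongr
  have := mul_lt_mul_of_pos_right hK hX
  linarith

lemma sign_phi {m n : ℕ} (hn : 2 ≤ n) (A : Fin m → Fin n → ℝ)
    (h : ∀ v : Fin n → ℝ, Cheb v → Cheb (phi A v)) :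
    ∃ p : Fin m → Fin n, (∀ i j, j ≠ p i → |A i j| < |A i (p i)|) ∧
      ∀ v, Cheb v → ∀ i, Real.sign (phi A v i) = Real.sign (A i (p i)) * Real.sign (v (p i)) := by
  choose p hp using fun i => row_argmax hn (A i) (fun v hv => h v hv i)
  exact ⟨p, hp, fun v hv i => sign_mu hn (A i) (fun v hv => h v hv i) (p i) (hp i) v hv⟩

lemma vseq_cheb {m n : ℕ} (A : Fin m → Fin n → ℝ) (hA : PreservesCheb A) (v : Fin n → ℝ)
    (hv : Cheb v) (k : ℕ) : Cheb (vseq A v k) := by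
  induction k with
  | zero => exact hv
  | succ k ih => exact hA.2 _ (hA.1 _ ih)

lemma sign_T {m n : ℕ} (hm : 2 ≤ m) (hn : 2 ≤ n) (A : Fin m → Fin n → ℝ)
    (hA : PreservesCheb A) (v w : Fin n → ℝ) (hv : Cheb v) (hw : Cheb w)
    (h : ∀ j, Real.sign (v j) = Real.sign (w j)) :
    (∀ i, Real.sign (phi A v i) = Real.sign (phi A w i)) ∧
    ∀ j, Real.sign (psi A (phi A v) j) = Real.sign (psi A (phi A w) j) := by
  obtain ⟨p, -, hp⟩ := sign_phi hn A hA.1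
  obtain ⟨q, -, hq⟩ := sign_phi hm (fun j i => A i j) hA.2
  have h1 : ∀ i, Real.sign (phi A v i) = Real.sign (phi A w i) := fun i => by
    rw [hp v hv, hp w hw, h]
  refine ⟨h1, fun j => ?_⟩
  have e1 := hq (phi A v) (hA.1 v hv) j
  have e2 := hq (phi A w) (hA.1 w hw) j
  rw [h1] at e1
  exact e1.trans e2.symm

lemma sign_pm {x : ℝ} (h : x = 1 ∨ x = -1) : Real.sign x = x := by
  rcases h with h | h
  · rw [h, Real.sign_one]
  · rw [h, Real.sign_neg, Real.sign_one]

/-- The signs of the iterates stabilize. -/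
lemma sign_stab {m n : ℕ} (hm : 2 ≤ m) (hn : 2 ≤ n) (A : Fin m → Fin n → ℝ)
    (hA : PreservesCheb A) (v : Fin n → ℝ) (hv : Cheb v) :
    ∃ N, ∀ j, Real.sign (vseq A v (N + 1) j) = Real.sign (vseq A v N j) := by
  obtain ⟨p, hp1, hp⟩ := sign_phi hn A hA.1
  obtain ⟨q, hq1, hq⟩ := sign_phi hm (fun j i => A i j) hA.2
  have hstep : ∀ k j, Real.sign (vseq A v (k + 1) j) =
      Real.sign (A (q j) j) * (Real.sign (A (q j) (p (q j))) * Real.sign (vseq A v k (p (q j)))) := by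
    intro k j
    rw [← hp _ (vseq_cheb A hA v hv k)]
    exact hq _ (hA.1 _ (vseq_cheb A hA v hv k)) j
  let c : Fin n → ℝ := fun j => |A (q j) j|
  have hc0 : ∀ j, 0 < c j := fun j => argmax_pos hm (fun i => A i j) (q j) (hq1 j)
  let r : Fin n → Fin n → Prop := fun a b => c b < c a
  have wf : WellFounded r := by
    have : IsTrans (Fin n) r := ⟨fun a b d h1 h2 => lt_trans h2 h1⟩
    have : Std.Irrefl r := ⟨fun a h => lt_irrefl _ h⟩
    exact Finite.wellFounded_of_trans_of_irrefl r
  have hj : ∀ j, ∃ N, ∀ k, N ≤ k →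
      Real.sign (vseq A v (k + 1) j) = Real.sign (vseq A v k j) := by
    intro j
    induction j using wf.induction with
    | _ j ih =>
      by_cases hf : p (q j) = j
      · refine ⟨0, fun k _ => ?_⟩
        rw [hstep, hf, ← mul_assoc, sign_sq' (abs_pos.1 (hc0 j)), one_mul]
      · have hlt : c j < c (p (q j)) := by
          refine lt_of_lt_of_le (hp1 (q j) j (Ne.symm hf)) ?_
          by_cases hqq : q j = q (p (q j))
          · show |A (q j) (p (q j))| ≤ |A (q (p (q j))) (p (q j))|
            rw [← hqq]
          · exact (hq1 (p (q j)) (q j) hqq).le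
        obtain ⟨N, hN⟩ := ih (p (q j)) hlt
        refine ⟨N + 1, fun k hk => ?_⟩
        obtain ⟨l, rfl⟩ : ∃ l, k = l + 1 := ⟨k - 1, by omega⟩
        rw [hstep, hN l (by omega), ← hstep]
  choose N hN using hj
  refine ⟨∑ j, N j, fun j => hN j _ ?_⟩
  exact Finset.single_le_sum (f := N) (fun _ _ => Nat.zero_le _) (Finset.mem_univ j)

lemma phi_alt {m n : ℕ} (hn : 2 ≤ n) (A : Fin m → Fin n → ℝ) (v t : Fin n → ℝ) (s : Fin m → ℝ)
    (hv : Cheb v) (ht : ∀ j, Real.sign (v j) = t j) (hs : ∀ i, s i = 1 ∨ s i = -1) :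
    RowAlt (fun i j => s i * t j * A i j) (fun i => s i * phi A v i) (fun j => t j * v j) := by
  intro i
  have e : ∀ j, s i * t j * A i j - s i * phi A v i * (t j * v j) =
      s i * (Real.sign (v j) * (A i j - mu (A i) v * v j)) := by
    intro j; rw [ht]; simp only [phi]; ring
  refine ⟨‖A i - mu (A i) v • v‖, ?_, ?_⟩
  · intro j
    dsimp only
    rw [e, abs_mul, abs_mul, abs_sign' (hv j)]
    have : |s i| = 1 := by rcases hs i with h | h <;> simp [h]
    rw [this, one_mul, one_mul]
    exact norm_le_pi_norm (A i - mu (A i) v • v) j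
  · obtain ⟨j, hj⟩ := alt_plus (by omega) (A i) v hv _ (mu_spec (A i) v)
    obtain ⟨k, hk⟩ := alt_minus (by omega) (A i) v hv _ (mu_spec (A i) v)
    dsimp only
    rcases hs i with h | h
    · exact ⟨⟨j, by rw [e, hj, h, one_mul]⟩, ⟨k, by rw [e, hk, h, one_mul]⟩⟩
    · exact ⟨⟨k, by rw [e, hk, h]; ring⟩, ⟨j, by rw [e, hj, h]; ring⟩⟩

lemma Cerr_step {m n : ℕ} (A : Fin m → Fin n → ℝ) (v : Fin n → ℝ) (k : ℕ) :
    Cerr A (phi A (vseq A v k)) (vseq A v (k + 1)) ≤ Cerr A (phi A (vseq A v k)) (vseq A v k) :=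
  Cerr_psi_le A _ _

lemma Cerr_anti {m n : ℕ} (A : Fin m → Fin n → ℝ) (v : Fin n → ℝ) :
    Antitone fun k => Cerr A (phi A (vseq A v k)) (vseq A v k) :=
  antitone_nat_of_succ_le fun k => (Cerr_phi_le A _ _).trans (Cerr_step A v k)

lemma EE_le {m n : ℕ} (hm : 2 ≤ m) (hn : 2 ≤ n) (A : Fin m → Fin n → ℝ)
    (hA : PreservesCheb A) (t : Fin n → ℝ) (ht : ∀ j, t j = 1 ∨ t j = -1) (hfix : SignV A t = t)
    (v : Fin n → ℝ) (hv : Cheb v) (hvt : ∀ j, Real.sign (v j) = t j) :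
    EE A t ≤ Cerr A (phi A v) v := by
  have htc : Cheb t := fun j => by rcases ht j with h | h <;> rw [h] <;> norm_num
  have hsq : ∀ k, ∀ j, Real.sign (vseq A t k j) = t j := by
    intro k
    induction k with
    | zero => exact fun j => sign_pm (ht j)
    | succ k ih =>
      intro j
      have := (sign_T hm hn A hA (vseq A t k) t (vseq_cheb A hA t htc k) htc
        (fun j => by rw [ih, sign_pm (ht j)])).2 j
      exact this.trans (congrFun hfix j)
  have hvc := vseq_cheb A hA t htc
  set s : Fin m → ℝ := fun i => Real.sign (phi A t i) with hsd
  have hs : ∀ i, s i = 1 ∨ s i = -1 := fun i =>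
    (Real.sign_apply_eq_of_ne_zero _ (hA.1 t htc i)).symm
  have hus : ∀ k i, Real.sign (phi A (vseq A t k) i) = s i := fun k =>
    (sign_T hm hn A hA (vseq A t k) t (hvc k) htc (fun j => by rw [hsq, sign_pm (ht j)])).1
  have hvs : ∀ i, Real.sign (phi A v i) = s i :=
    (sign_T hm hn A hA v t hv htc (fun j => by rw [hvt, sign_pm (ht j)])).1
  obtain ⟨C1, hC1⟩ := phi_comp hn A hA.1
  obtain ⟨C2, hC2⟩ := phi_comp hm (fun j i => A i j) hA.2
  set C := max (max C1 C2) 1 with hC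
  have hc1 : C1 ≤ C := (le_max_left _ _).trans (le_max_left _ _)
  have hc2 : C2 ≤ C := (le_max_right _ _).trans (le_max_left _ _)
  have hc3 : 1 ≤ C := le_max_right _ _
  have eU : ∀ k i, s i * phi A (vseq A t k) i = |phi A (vseq A t k) i| := fun k i => by
    rw [← hus k i, sign_mul_abs']
  have eV : ∀ k j, t j * vseq A t k j = |vseq A t k j| := fun k j => by
    rw [← hsq k j, sign_mul_abs']
  have eB : ∀ (i : Fin m) (j : Fin n) (x y : ℝ),
      |s i * t j * A i j - s i * x * (t j * y)| = |A i j - x * y| := by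
    intro i j x y
    have : s i * t j * A i j - s i * x * (t j * y) = s i * t j * (A i j - x * y) := by ring
    rw [this, abs_mul, abs_mul]
    have h1 : |s i| = 1 := by rcases hs i with h | h <;> simp [h]
    have h2 : |t j| = 1 := by rcases ht j with h | h <;> simp [h]
    rw [h1, h2]; ring
  have hbdd : BddBelow (Set.range fun k => Cerr A (phi A (vseq A t k)) (vseq A t k)) :=
    ⟨0, by rintro _ ⟨k, rfl⟩; exact Cerr_nonneg _ _ _⟩
  refine main_abstract (fun i j => s i * t j * A i j) (fun k i => s i * phi A (vseq A t k) i)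
    (fun k j => t j * vseq A t k j) (fun i => s i * phi A v i) (fun j => t j * v j) (EE A t) C
    (Cerr A (phi A v) v) ?_ ?_ ?_ ?_ (by linarith) ?_ ?_ ?_ ?_ ?_ ?_ ?_
  · intro k i; rw [eU]; exact abs_pos.2 (hA.1 _ (hvc k) i)
  · intro i; rw [← hvs i, sign_mul_abs']; exact abs_pos.2 (hA.1 _ hv i)
  · intro k j; rw [eV]; exact abs_pos.2 (hvc k j)
  · intro j; rw [← hvt j, sign_mul_abs']; exact abs_pos.2 (hv j)
  · intro k i i'; rw [eU, eU]
    exact (hC1 _ (hvc k) i i').trans (mul_le_mul_of_nonneg_right hc1 (abs_nonneg _))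
  · intro k i i'; rw [eV, eV]
    cases k with
    | zero =>
      have h2 : ∀ j, |t j| = 1 := fun j => by rcases ht j with h | h <;> simp [h]
      show |t i| ≤ C * |t i'|
      rw [h2, h2]; linarith
    | succ k =>
      exact (hC2 _ (hA.1 _ (hvc k)) i i').trans (mul_le_mul_of_nonneg_right hc2 (abs_nonneg _))
  · intro k
    obtain ⟨i, j, hij⟩ := Cerr_attained (by omega) (by omega) A (phi A (vseq A t k)) (vseq A t k)
    refine ⟨i, j, ?_⟩
    rw [eB, hij]
    exact ciInf_le hbdd k
  · intro ε hε
    obtain ⟨k, hk⟩ := exists_lt_of_ciInf_lt (show EE A t < EE A t + ε by linarith)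
    refine ⟨k, fun l hl i j => ?_⟩
    rw [eB, eB]
    have h1 := (Cerr_anti A t hl).trans hk.le
    exact ⟨(le_Cerr A _ _ i j).trans h1, (le_Cerr A _ _ i j).trans ((Cerr_step A t l).trans h1)⟩
  · intro k
    exact phi_alt hn A (vseq A t k) t s (hvc k) (hsq k) hs
  · intro k
    have := phi_alt hm (fun j i => A i j) (phi A (vseq A t k)) s t (hA.1 _ (hvc k)) (hus k) ht
    have e : (fun (j : Fin n) (i : Fin m) => s i * t j * A i j) =
        fun j i => t j * s i * A i j := by
      funext j i; ring
    rw [e]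
    exact this
  · intro i j
    rw [eB]
    exact le_Cerr A _ _ i j

/-- From any Chebyshev start, a fixed sign pattern with no larger limit error. -/
lemma exists_fix {m n : ℕ} (hm : 2 ≤ m) (hn : 2 ≤ n) (A : Fin m → Fin n → ℝ)
    (hA : PreservesCheb A) (v : Fin n → ℝ) (hv : Cheb v) (u : Fin m → ℝ) :
    ∃ t : Fin n → ℝ, ((∀ j, t j = 1 ∨ t j = -1) ∧ SignV A t = t) ∧ EE A t ≤ Cerr A u v := by
  obtain ⟨N, hN⟩ := sign_stab hm hn A hA v hv
  have hc := vseq_cheb A hA v hv N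
  have ht : ∀ j, Real.sign (vseq A v N j) = 1 ∨ Real.sign (vseq A v N j) = -1 := fun j =>
    (Real.sign_apply_eq_of_ne_zero _ (hc j)).symm
  have htc : Cheb fun j => Real.sign (vseq A v N j) := fun j => by
    rcases ht j with h | h <;> dsimp only <;> rw [h] <;> norm_num
  have hfix : SignV A (fun j => Real.sign (vseq A v N j)) = fun j => Real.sign (vseq A v N j) := by
    funext j
    rw [← hN j]
    exact (sign_T hm hn A hA _ (vseq A v N) htc hc (fun j => sign_pm (ht j))).2 j
  refine ⟨fun j => Real.sign (vseq A v N j), ⟨ht, hfix⟩, ?_⟩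
  refine (EE_le hm hn A hA _ ht hfix (vseq A v N) hc fun j => rfl).trans ?_
  exact (Cerr_anti A v (Nat.zero_le N)).trans (Cerr_phi_le A u v)

/-- Chebyshev vectors are dense. -/
lemma cheb_approx {m n : ℕ} (A : Fin m → Fin n → ℝ) (u : Fin m → ℝ) (v : Fin n → ℝ) (ε : ℝ)
    (hε : 0 < ε) : ∃ w, Cheb w ∧ Cerr A u w ≤ Cerr A u v + ε := by
  set η := ε / (‖u‖ + 1) with hη
  have hη0 : 0 < η := by positivity
  refine ⟨fun j => if v j = 0 then η else v j, ?_, ?_⟩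
  · intro j
    dsimp only
    split_ifs with h
    · exact hη0.ne'
    · exact h
  · refine Cerr_le _ _ _ _ (by have := Cerr_nonneg A u v; linarith) fun i j => ?_
    have h1 := le_Cerr A u v i j
    split_ifs with h
    · rw [h, mul_zero, sub_zero] at h1
      have h2 := abs_sub (A i j) (u i * η)
      have h3 : |u i * η| ≤ ε := by
        rw [abs_mul, abs_of_pos hη0]
        have : |u i| ≤ ‖u‖ := norm_le_pi_norm u i
        calc |u i| * η ≤ (‖u‖ + 1) * η := by gcongr; linarith
          _ = ε := by rw [hη]; field_simp
      linarith
    · linarith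

theorem stmt19 {m n : ℕ} (hm : 2 ≤ m) (hn : 2 ≤ n) (A : Fin m → Fin n → ℝ)
    (hA : PreservesCheb A) :
    IsLeast {x : ℝ | ∃ t : Fin n → ℝ,
        ((∀ j, t j = 1 ∨ t j = -1) ∧ SignV A t = t) ∧ x = EE A t}
      (⨅ u : Fin m → ℝ, ⨅ v : Fin n → ℝ, Cerr A u v) := by
  have hbd1 : ∀ u : Fin m → ℝ, BddBelow (Set.range fun v : Fin n → ℝ => Cerr A u v) := fun u =>
    ⟨0, by rintro _ ⟨v, rfl⟩; exact Cerr_nonneg _ _ _⟩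
  have hbd2 : BddBelow (Set.range fun u : Fin m → ℝ => ⨅ v : Fin n → ℝ, Cerr A u v) :=
    ⟨0, by rintro _ ⟨u, rfl⟩; exact Real.iInf_nonneg fun v => Cerr_nonneg _ _ _⟩
  have hlow : ∀ t : Fin n → ℝ, (⨅ u : Fin m → ℝ, ⨅ v : Fin n → ℝ, Cerr A u v) ≤ EE A t := by
    intro t
    refine le_ciInf fun k => ?_
    exact (ciInf_le hbd2 (phi A (vseq A t k))).trans (ciInf_le (hbd1 _) (vseq A t k))
  refine ⟨?_, ?_⟩
  · let L : Set (Fin n → ℝ) := {t | (∀ j, t j = 1 ∨ t j = -1) ∧ SignV A t = t}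
    have hfin : L.Finite := by
      refine (Set.Finite.pi' (t := fun _ : Fin n => ({1, -1} : Set ℝ))
        (fun _ => Set.toFinite _)).subset ?_
      intro t ht j
      exact ht.1 j
    have hne : L.Nonempty := by
      obtain ⟨t, ht, -⟩ := exists_fix hm hn A hA (fun _ => 1) (fun _ => one_ne_zero) 0
      exact ⟨t, ht⟩
    obtain ⟨t, ht, hmin⟩ := Set.exists_min_image L (EE A) hfin hne
    refine ⟨t, ht, le_antisymm (hlow t) ?_⟩
    refine le_ciInf fun u => le_ciInf fun v => ?_
    refine le_of_forall_pos_le_add fun ε hε => ?_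
    obtain ⟨w, hw, hwe⟩ := cheb_approx A u v ε hε
    obtain ⟨t', ht', hle⟩ := exists_fix hm hn A hA w hw u
    exact (hmin t' ht').trans (hle.trans hwe)
  · rintro x ⟨t, -, rfl⟩
    exact hlow t
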